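/- arXiv:1504.02976 — 3 statements merged into one kernel-verified Lean document; each statement's English description precedes it below -/
import Mathlib

section
/- Let n ≥ 1 and s > 0. There exist ε > 0 and, for each μ ∈ ℝ with |μ − 1| < ε, a map f_μ : ℝⁿ → ℝⁿ such that: (1) f_μ is bijective and both f_μ and its inverse are C^∞; (2) f_μ(0) = 0; (3) f_μ(x) = x for every x with ‖x‖ ≥ s; (4) f_μ(x) = μ·x for every x with ‖x‖ ≤ s/2 (in particular the derivative of f_μ at 0 is μ times the identity); and (5) the map (μ, x) ↦ f_μ(x) is jointly C^∞ on {μ : |μ − 1| < ε} × ℝⁿ. -/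
open Function

/-- A Lipschitz perturbation of the identity with constant `< 1` approximates the identity
well enough to be a homeomorphism; if it is `C^k`, then so is its inverse. -/
theorem bijective_and_contDiff_invFun_id_add {E : Type*} [NormedAddCommGroup E]
    [NormedSpace ℝ E] [CompleteSpace E] {k : WithTop ℕ∞} (hk : k ≠ 0) {g : E → E}
    (hg : ContDiff ℝ k g) {c : NNReal} (hc : c < 1) (hL : LipschitzWith c g) :
    Bijective (fun x => x + g x) ∧ ContDiff ℝ k (invFun fun x => x + g x) := by
  have approx : ApproximatesLinearOn (fun x => x + g x)
      (ContinuousLinearEquiv.refl ℝ E : E →L[ℝ] E) Set.univ c := by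
    rw [ApproximatesLinearOn.approximatesLinearOn_iff_lipschitzOnWith, lipschitzOnWith_univ]
    convert hL using 1
    ext x
    simp
  have small : Subsingleton E ∨
      c < ‖((ContinuousLinearEquiv.refl ℝ E).symm : E →L[ℝ] E)‖₊⁻¹ := by
    rcases subsingleton_or_nontrivial E with h | h
    · exact Or.inl h
    · refine Or.inr ?_
      have h_one : ‖((ContinuousLinearEquiv.refl ℝ E).symm : E →L[ℝ] E)‖₊ = 1 :=
        NNReal.eq ContinuousLinearMap.norm_id
      rwa [h_one, inv_one]
  let e : E ≃ₜ E := approx.toHomeomorph _ small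
  have coe_e : (fun x => x + g x) = e := rfl
  have inv_e : invFun e = e.symm :=
    invFun_eq_of_injective_of_rightInverse e.injective e.apply_symm_apply
  have norm_lt (a : E) : ‖-fderiv ℝ g a‖ < 1 := by
    rw [norm_neg]
    exact (norm_fderiv_le_of_lipschitz ℝ hL).trans_lt (by exact_mod_cast hc)
  rw [coe_e, inv_e]
  refine ⟨e.bijective, e.contDiff_symm
    (f₀' := fun a => ContinuousLinearEquiv.ofUnit (Units.oneSub _ (norm_lt a)))
    (fun a => ?_) (contDiff_id.add hg)⟩
  refine ((hasFDerivAt_id a).add (hg.differentiable hk a).hasFDerivAt).congr_fderiv ?_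
  ext v
  change v + fderiv ℝ g a v = (1 - -fderiv ℝ g a) v
  simp

/-- Perturbation lemma in `ℝⁿ`: for every `s > 0` there is `ε > 0` and a family of
`C^∞` diffeomorphisms `f_μ` of `ℝⁿ` (for `|μ - 1| < ε`) fixing `0`, equal to the
identity outside the ball of radius `s`, equal to `x ↦ μ • x` on the ball of radius
`s / 2`, and depending jointly smoothly on `(μ, x)`. -/
theorem stmt2 (n : ℕ) (hn : 1 ≤ n) (s : ℝ) (hs : 0 < s) :
    ∃ ε > 0, ∃ f : ℝ → EuclideanSpace ℝ (Fin n) → EuclideanSpace ℝ (Fin n),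
      (∀ μ : ℝ, |μ - 1| < ε →
        Function.Bijective (f μ) ∧
        ContDiff ℝ (⊤ : ℕ∞) (f μ) ∧
        ContDiff ℝ (⊤ : ℕ∞) (Function.invFun (f μ)) ∧
        f μ 0 = 0 ∧
        (∀ x : EuclideanSpace ℝ (Fin n), s ≤ ‖x‖ → f μ x = x) ∧
        (∀ x : EuclideanSpace ℝ (Fin n), ‖x‖ ≤ s / 2 → f μ x = μ • x)) ∧
      ContDiffOn ℝ (⊤ : ℕ∞) (fun p : ℝ × EuclideanSpace ℝ (Fin n) => f p.1 p.2)
        ({μ : ℝ | |μ - 1| < ε} ×ˢ (Set.univ : Set (EuclideanSpace ℝ (Fin n)))) := by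
  let φ : ContDiffBump (0 : EuclideanSpace ℝ (Fin n)) := ⟨s / 2, s, by linarith, by linarith⟩
  have smooth : ContDiff ℝ (⊤ : ℕ∞) fun x => φ x • x := φ.contDiff.smul contDiff_id
  obtain ⟨C, hC⟩ := ContDiff.lipschitzWith_of_hasCompactSupport
    (φ.hasCompactSupport.smul_right (f' := fun x => x)) smooth (by simp)
  refine ⟨1 / (C + 1), by positivity, fun μ x => x + (μ - 1) • φ x • x, fun μ hμ => ?_, ?_⟩
  · have contraction : ‖μ - 1‖₊ * C < 1 := by
      rw [← NNReal.coe_lt_coe]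
      push_cast
      rw [Real.norm_eq_abs]
      rw [lt_div_iff₀ (by positivity)] at hμ
      linarith [abs_nonneg (μ - 1)]
    have smooth_smul : ContDiff ℝ (⊤ : ℕ∞) fun x => (μ - 1) • φ x • x := smooth.const_smul _
    obtain ⟨bij, smooth_inv⟩ := bijective_and_contDiff_invFun_id_add (by simp) smooth_smul
      contraction ((lipschitzWith_smul (μ - 1)).comp hC)
    refine ⟨bij, contDiff_id.add smooth_smul, smooth_inv, by simp, fun x hx => ?_, fun x hx => ?_⟩
    · have : φ x = 0 := φ.zero_of_le_dist (by simpa using hx)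
      simp [this]
    · have : φ x = 1 := φ.one_of_mem_closedBall (by simpa using hx)
      simp [this, sub_smul]
  · exact (contDiff_snd.add ((contDiff_fst.sub contDiff_const).smul
      (smooth.comp contDiff_snd))).contDiffOn
end

section
/- Let X be a compact metric space and f : X → X a homeomorphism. If f is countably-expansive, then f is cw-expansive: there exists δ > 0 such that every connected subset C ⊆ X containing at least two points satisfies diam(fⁿ(C)) > δ for some n ∈ ℤ. -/
/-- Every countably-expansive homeomorphism of a compact metric space is
cw-expansive: some `δ > 0` works so that every connected set with at least two
points has an iterate of diameter greater than `δ`. -/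
theorem stmt7 {X : Type*} [MetricSpace X] [CompactSpace X] (f : X ≃ₜ X)
    (hce : ∃ δ > (0 : ℝ), ∀ x : X,
      Set.Countable {y : X | ∀ n : ℤ,
        dist ((f.toEquiv ^ n) x) ((f.toEquiv ^ n) y) ≤ δ}) :
    ∃ δ > (0 : ℝ), ∀ C : Set X, IsConnected C → C.Nontrivial →
      ∃ n : ℤ, δ < Metric.diam (⇑(f.toEquiv ^ n) '' C) := by
  obtain ⟨δ, hδ, hcount⟩ := hce
  refine ⟨δ, hδ, fun C hC hnt => ?_⟩
  by_contra! hdiam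
  obtain ⟨x, hx, y, hy, hxy⟩ := hnt
  have hCc : C.Countable := (hcount x).mono fun z hz n =>
    (Metric.dist_le_diam_of_mem Metric.isBounded_of_compactSpace
      (Set.mem_image_of_mem _ hx) (Set.mem_image_of_mem _ hz)).trans (hdiam n)
  exact hxy (hCc.isTotallyDisconnected C subset_rfl hC.isPreconnected hx hy)
end

section
/- Let r ≥ 1 be an integer, let ρ : ℝ² → ℝ be a C^∞ function whose support is contained in the closed unit ball, and let R : ℝ → ℝ be a function of class C^r with R⁽ᵗ⁾(0) = 0 for all t = 0, 1, …, r. For μ > 0 define l_μ : ℝ² → ℝ by l_μ(x,y) = ρ(x/μ, y/μ)·R(x). Then l_μ → 0 in the C^r norm as μ → 0⁺: for every ε > 0 there exists μ₀ > 0 such that for all μ ∈ (0, μ₀), all nonnegative integers i, j with i + j ≤ r, and all (x,y) ∈ ℝ², one has |∂ᵢₓ∂ʲ_y l_μ(x,y)| ≤ ε. -/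
/-- The directional derivative of `f` along the constant vector field `v`. -/
noncomputable def dirDeriv {E : Type*} [NormedAddCommGroup E] [NormedSpace ℝ E]
    (v : E) (f : E → ℝ) : E → ℝ :=
  fun p => fderiv ℝ f p v

/-- Iterated directional derivatives of a smooth function are smooth. -/
theorem contDiff_iterate_dirDeriv {E : Type*} [NormedAddCommGroup E] [NormedSpace ℝ E]
    {f : E → ℝ} (hf : ContDiff ℝ (⊤ : ℕ∞) f) (v : E) (k : ℕ) :
    ContDiff ℝ (⊤ : ℕ∞) ((dirDeriv v)^[k] f) := by
  induction k with
  | zero => exact hf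
  | succ k ih =>
    rw [Function.iterate_succ_apply']
    exact (ih.fderiv_right (by simp)).clm_apply contDiff_const

/-- Directional derivatives vanish on every open set where the function does. -/
theorem iterate_dirDeriv_eq_zero_of_isOpen {E : Type*} [NormedAddCommGroup E] [NormedSpace ℝ E]
    {f : E → ℝ} {U : Set E} (hU : IsOpen U) (hf : ∀ p ∈ U, f p = 0) (v : E) (k : ℕ) :
    ∀ p ∈ U, (dirDeriv v)^[k] f p = 0 := by
  induction k with
  | zero => exact hf
  | succ k ih =>
    intro p hp
    have h : (dirDeriv v)^[k] f =ᶠ[nhds p] fun _ => 0 := by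
      filter_upwards [hU.mem_nhds hp] using ih
    rw [Function.iterate_succ_apply', dirDeriv, h.fderiv_eq]
    simp

/-- Iterated derivatives of a smooth function along a path with constant velocity `c • v`. -/
theorem iteratedDeriv_comp_of_hasDerivAt_const {E : Type*} [NormedAddCommGroup E]
    [NormedSpace ℝ E] {f : E → ℝ} (hf : ContDiff ℝ (⊤ : ℕ∞) f) {γ : ℝ → E} {c : ℝ} {v : E}
    (hγ : ∀ t, HasDerivAt γ (c • v) t) (k : ℕ) :
    iteratedDeriv k (fun t => f (γ t)) = fun t => c ^ k * (dirDeriv v)^[k] f (γ t) := by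
  induction k with
  | zero => simp
  | succ k ih =>
    rw [iteratedDeriv_succ, ih]
    ext t
    have hd : DifferentiableAt ℝ ((dirDeriv v)^[k] f) (γ t) :=
      (contDiff_iterate_dirDeriv hf v k).differentiable (by simp) _
    have h := (hd.hasFDerivAt.comp_hasDerivAt t (hγ t)).const_mul (c ^ k)
    refine h.deriv.trans ?_
    rw [Function.iterate_succ_apply', dirDeriv]
    simp only [map_smul, smul_eq_mul]
    ring

/-- A continuous function on the plane vanishing outside the Euclidean unit ball is bounded. -/
theorem exists_bound_of_eq_zero_outside_unit_ball {f : ℝ × ℝ → ℝ} (hf : Continuous f)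
    (h : ∀ p ∈ {p : ℝ × ℝ | 1 < p.1 ^ 2 + p.2 ^ 2}, f p = 0) :
    ∃ C, 0 < C ∧ ∀ p, |f p| ≤ C := by
  obtain ⟨C, hC⟩ := (isCompact_closedBall (0 : ℝ × ℝ) 1).exists_bound_of_continuousOn
    hf.continuousOn
  refine ⟨max C 1, by positivity, fun p => ?_⟩
  by_cases hp : p ∈ Metric.closedBall (0 : ℝ × ℝ) 1
  · exact (hC p hp).trans (le_max_left _ _)
  · rw [h p, abs_zero]
    · positivity
    · by_contra hle
      simp only [Set.mem_ofPred_eq, not_lt] at hle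
      apply hp
      rw [mem_closedBall_zero_iff, Prod.norm_def, max_le_iff, Real.norm_eq_abs, Real.norm_eq_abs]
      constructor <;> rw [← sq_le_one_iff_abs_le_one] <;>
        nlinarith [sq_nonneg p.1, sq_nonneg p.2]

/-- If all derivatives of `R` up to order `r` vanish at `0`, then
`R⁽ᵗ⁾(x) = o(x ^ (r - t))` as `x → 0`. -/
theorem exists_abs_iteratedDeriv_le_mul_pow_of_flat {r : ℕ} {R : ℝ → ℝ}
    (hR : ContDiff ℝ (r : ℕ∞) R) (hflat : ∀ t : ℕ, t ≤ r → iteratedDeriv t R 0 = 0)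
    {δ : ℝ} (hδ : 0 < δ) :
    ∃ η > 0, ∀ s t : ℕ, s + t = r → ∀ x : ℝ, |x| < η → |iteratedDeriv t R x| ≤ δ * |x| ^ s := by
  have hcont : Continuous (iteratedDeriv r R) := hR.continuous_iteratedDeriv r le_rfl
  obtain ⟨η, hη, hball⟩ := Metric.continuousAt_iff.1 (hcont.continuousAt (x := 0)) δ hδ
  refine ⟨η, hη, fun s => ?_⟩
  induction s with
  | zero =>
    intro t ht x hx
    obtain rfl : t = r := by omega
    have := hball (x := x) (by simpa using hx)
    rw [Real.dist_eq, hflat t le_rfl, sub_zero] at this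
    simpa using this.le
  | succ s ih =>
    intro t ht x hx
    have hbound : ∀ z ∈ Set.Icc (-|x|) |x|, ‖deriv (iteratedDeriv t R) z‖ ≤ δ * |x| ^ s := by
      intro z hz
      have hzx : |z| ≤ |x| := abs_le.2 hz
      rw [← iteratedDeriv_succ, Real.norm_eq_abs]
      refine (ih (t + 1) (by omega) z (hzx.trans_lt hx)).trans ?_
      gcongr
    have hdiff : Differentiable ℝ (iteratedDeriv t R) :=
      hR.differentiable_iteratedDeriv t (by exact_mod_cast (by omega : t < r))
    have h := (convex_Icc (-|x|) |x|).norm_image_sub_le_of_norm_deriv_le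
      (fun z _ => hdiff z) hbound (x := 0) (y := x) (by simp) (abs_le.1 le_rfl)
    rw [hflat t (by omega), sub_zero, sub_zero, Real.norm_eq_abs, Real.norm_eq_abs] at h
    rwa [pow_succ, ← mul_assoc]

/-- The scaled mixed partial derivatives of a compactly supported bump, multiplied by a
derivative of a flat function, are uniformly small. -/
theorem eventually_abs_scaled_mul_iteratedDeriv_le {r : ℕ} {g : ℝ × ℝ → ℝ} (hg : Continuous g)
    (hsupp : ∀ p ∈ {p : ℝ × ℝ | 1 < p.1 ^ 2 + p.2 ^ 2}, g p = 0) {R : ℝ → ℝ}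
    (hR : ContDiff ℝ (r : ℕ∞) R) (hflat : ∀ t : ℕ, t ≤ r → iteratedDeriv t R 0 = 0)
    {m t : ℕ} (hmt : m + t ≤ r) {ε : ℝ} (hε : 0 < ε) :
    ∀ᶠ μ in nhdsWithin (0 : ℝ) (Set.Ioi 0), ∀ x y : ℝ,
      |μ⁻¹ ^ m * g (x / μ, y / μ) * iteratedDeriv t R x| ≤ ε := by
  obtain ⟨C, hC, hgC⟩ := exists_bound_of_eq_zero_outside_unit_ball hg hsupp
  obtain ⟨η, hη, hRη⟩ := exists_abs_iteratedDeriv_le_mul_pow_of_flat hR hflat (div_pos hε hC)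
  filter_upwards [Ioo_mem_nhdsGT (lt_min hη one_pos)] with μ ⟨hμ, hμη⟩ x y
  by_cases hxy : 1 < (x / μ) ^ 2 + (y / μ) ^ 2
  · rw [hsupp (x / μ, y / μ) hxy]
    simpa using hε.le
  · have hx : |x| ≤ μ := by
      have h1 : (x / μ) ^ 2 ≤ 1 := by nlinarith [sq_nonneg (y / μ)]
      have h2 : |x / μ| ≤ 1 := (sq_le_one_iff_abs_le_one _).1 h1
      rwa [abs_div, abs_of_pos hμ, div_le_one hμ] at h2
    have hRx := hRη (r - t) t (by omega) x (hx.trans_lt (hμη.trans_le (min_le_left _ _)))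
    have hpow : |x| ^ (r - t) ≤ μ ^ m :=
      (pow_le_pow_left₀ (abs_nonneg x) hx _).trans
        (pow_le_pow_of_le_one hμ.le (hμη.trans_le (min_le_right _ _)).le (by omega))
    rw [abs_mul, abs_mul, abs_of_pos (by positivity : 0 < μ⁻¹ ^ m)]
    calc μ⁻¹ ^ m * |g (x / μ, y / μ)| * |iteratedDeriv t R x|
        ≤ μ⁻¹ ^ m * C * (ε / C * μ ^ m) := by
          gcongr
          · exact hgC _
          · exact hRx.trans (by gcongr)
      _ = ε := by
          rw [inv_pow]
          field_simp

/-- Leibniz formula for the mixed partial derivatives of `ρ(x/μ, y/μ) · R(x)`. -/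
theorem iteratedDeriv_iteratedDeriv_scaled_mul {r : ℕ} {ρ : ℝ × ℝ → ℝ}
    (hρ : ContDiff ℝ (⊤ : ℕ∞) ρ) {R : ℝ → ℝ} (hR : ContDiff ℝ (r : ℕ∞) R) (μ : ℝ)
    {i : ℕ} (hi : i ≤ r) (j : ℕ) (x y : ℝ) :
    iteratedDeriv i
        (fun x' : ℝ => iteratedDeriv j (fun y' : ℝ => ρ (x' / μ, y' / μ) * R x') y) x =
      ∑ k ∈ Finset.range (i + 1), (i.choose k : ℝ) *
        (μ⁻¹ ^ (k + j) * (dirDeriv (1, 0))^[k] ((dirDeriv (0, 1))^[j] ρ) (x / μ, y / μ) *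
          iteratedDeriv (i - k) R x) := by
  set g := (dirDeriv ((0 : ℝ), (1 : ℝ)))^[j] ρ
  have hg : ContDiff ℝ (⊤ : ℕ∞) g := contDiff_iterate_dirDeriv hρ _ j
  have hdiv : ∀ t : ℝ, HasDerivAt (fun t => t / μ) μ⁻¹ t := fun t => by
    simpa using (hasDerivAt_id t).div_const μ
  have hinner : (fun x' : ℝ => iteratedDeriv j (fun y' : ℝ => ρ (x' / μ, y' / μ) * R x') y) =
      fun x' => μ⁻¹ ^ j * (g (x' / μ, y / μ) * R x') := by
    ext x'
    have hγ : ∀ t : ℝ, HasDerivAt (fun t => (x' / μ, t / μ)) (μ⁻¹ • ((0 : ℝ), (1 : ℝ))) t :=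
      fun t => by simpa using (hasDerivAt_const t (x' / μ)).prodMk (hdiv t)
    have h := congrFun (iteratedDeriv_comp_of_hasDerivAt_const hρ hγ j) y
    simp only [mul_comm _ (R x')]
    rw [iteratedDeriv_const_mul_field, h]
    ring
  have hγ : ∀ t : ℝ, HasDerivAt (fun t => (t / μ, y / μ)) (μ⁻¹ • ((1 : ℝ), (0 : ℝ))) t :=
    fun t => by simpa using (hdiv t).prodMk (hasDerivAt_const t (y / μ))
  have hgx : ContDiff ℝ (⊤ : ℕ∞) (fun x' : ℝ => g (x' / μ, y / μ)) := by fun_prop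
  rw [hinner, iteratedDeriv_const_mul_field, iteratedDeriv_fun_mul, Finset.mul_sum]
  · refine Finset.sum_congr rfl fun k _ => ?_
    rw [iteratedDeriv_comp_of_hasDerivAt_const hg hγ k]
    ring
  · exact (hgx.of_le (by exact_mod_cast le_top)).contDiffAt
  · exact (hR.of_le (by exact_mod_cast hi)).contDiffAt

/-- The perturbation `l_μ(x, y) = ρ(x/μ, y/μ) · R(x)`, where `ρ` is `C^∞` with
support in the closed unit ball and `R` is `C^r` and `r`-flat at `0`, tends to
`0` in the `C^r` norm as `μ → 0⁺`: all mixed partial derivatives of total order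
at most `r` are uniformly small. -/
theorem stmt11 (r : ℕ) (hr : 1 ≤ r) (ρ : ℝ × ℝ → ℝ) (hρ : ContDiff ℝ (⊤ : ℕ∞) ρ)
    (hsupp : ∀ x y : ℝ, 1 < x ^ 2 + y ^ 2 → ρ (x, y) = 0)
    (R : ℝ → ℝ) (hR : ContDiff ℝ (r : ℕ∞) R)
    (hflat : ∀ t : ℕ, t ≤ r → iteratedDeriv t R 0 = 0) :
    ∀ ε > (0 : ℝ), ∃ μ₀ > (0 : ℝ), ∀ μ : ℝ, 0 < μ → μ < μ₀ →
      ∀ i j : ℕ, i + j ≤ r → ∀ x y : ℝ,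
        |iteratedDeriv i
            (fun x' : ℝ => iteratedDeriv j (fun y' : ℝ => ρ (x' / μ, y' / μ) * R x') y)
            x| ≤ ε := by
  intro ε hε
  have hU : IsOpen {p : ℝ × ℝ | 1 < p.1 ^ 2 + p.2 ^ 2} :=
    isOpen_lt continuous_const (by fun_prop)
  have hev : ∀ᶠ μ in nhdsWithin (0 : ℝ) (Set.Ioi 0), ∀ i ∈ Finset.range (r + 1),
      ∀ j ∈ Finset.range (r + 1), ∀ k ∈ Finset.range (i + 1), i + j ≤ r → ∀ x y : ℝ,
        |μ⁻¹ ^ (k + j) * (dirDeriv (1, 0))^[k] ((dirDeriv (0, 1))^[j] ρ) (x / μ, y / μ) *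
          iteratedDeriv (i - k) R x| ≤ ε / 2 ^ r := by
    simp only [Filter.eventually_all_finset, Filter.eventually_imp_distrib_left]
    intro i _ j _ k hk hij
    rw [Finset.mem_range] at hk
    exact eventually_abs_scaled_mul_iteratedDeriv_le
      (contDiff_iterate_dirDeriv (contDiff_iterate_dirDeriv hρ _ j) _ k).continuous
      (iterate_dirDeriv_eq_zero_of_isOpen hU
        (iterate_dirDeriv_eq_zero_of_isOpen hU (fun p hp => hsupp p.1 p.2 hp) _ j) _ k)
      hR hflat (by omega) (by positivity)
  obtain ⟨μ₀, hμ₀, hsub⟩ := mem_nhdsGT_iff_exists_Ioo_subset.1 hev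
  refine ⟨μ₀, hμ₀, fun μ hμ hlt i j hij x y => ?_⟩
  have hterm := hsub ⟨hμ, hlt⟩ i (Finset.mem_range.2 (by omega)) j (Finset.mem_range.2 (by omega))
  rw [iteratedDeriv_iteratedDeriv_scaled_mul hρ hR μ (by omega) j x y]
  calc _ ≤ ∑ k ∈ Finset.range (i + 1), (i.choose k : ℝ) * (ε / 2 ^ r) := by
        refine (Finset.abs_sum_le_sum_abs _ _).trans (Finset.sum_le_sum fun k hk => ?_)
        rw [abs_mul, Nat.abs_cast]
        exact mul_le_mul_of_nonneg_left (hterm k hk hij x y) (Nat.cast_nonneg _)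
    _ = 2 ^ i * (ε / 2 ^ r) := by
        rw [← Finset.sum_mul, ← Nat.cast_sum, Nat.sum_range_choose]
        norm_num
    _ ≤ 2 ^ r * (ε / 2 ^ r) := by
        gcongr
        · norm_num
        · omega
    _ = ε := by field_simp
end
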